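/- Centralized KKT solutions decompose into the decentralized form (appendix, converse direction). With exactly the setup of the forward theorem (transmission data (H_T, G_T, R_Tx, R_Ty) with quadratic Lagrangian Φ_T; for each k ∈ κ distribution data (H_k, G_k, R_kx, R_ky) with blocks H_k^II, H_k^IB, G_k^I, G_k^B, invertible reduced KKT matrix K_k = fromBlocks H_k^II (G_k^I)ᵀ G_k^I 0, unique parametric solution (x_k^I(p), y_k(p)) and boundary value function Φ̃_k(p) = Φ_k((x_k^I(p), p), y_k(p)); global assembled data Ĥ, Ĝ, R̂x, R̂y on ι̂ = ι_T ⊕ ι_B ⊕ (Σ k, ι_k) and ρ̂ = ρ_T ⊕ (Σ k, ρ_k) via coordinate-selection matrices E_T, E_k): suppose x̂ : ι̂ → ℝ and ŷ : ρ̂ → ℝ satisfy Ĥ·x̂ + Ĝᵀ·ŷ = R̂x and Ĝ·x̂ = R̂y, and write p : ι_B → ℝ for the ι_B-component of x̂. Then for every k ∈ κ, the ι_k-component of x̂ equals x_k^I(p) and the ρ_k-component of ŷ equals y_k(p), and the triple consisting of the ι_T-component of x̂, p, and the ρ_T-component of ŷ is a stationary point (vanishing Fréchet derivative) of the function (a,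 q, y) ↦ Φ_T((a, q), y) + Σ_k Φ̃_k(q). -/

import Mathlib

open Matrix

/-- A coordinate-selection matrix: for an embedding `e : ι' → ιhat`, the 0–1 matrix
whose row `i` has a single `1` in column `e i`. -/
noncomputable def selectionMatrix {ι' ιhat : Type*} [DecidableEq ιhat]
    (e : ι' → ιhat) : Matrix ι' ιhat ℝ :=
  Matrix.of fun i j => if j = e i then 1 else 0

theorem selectionMatrix_mulVec {ι' ιhat : Type*} [Fintype ιhat] [DecidableEq ιhat]
    (e : ι' → ιhat) (v : ιhat → ℝ) : selectionMatrix e *ᵥ v = v ∘ e := by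
  funext i
  simp [selectionMatrix, mulVec, dotProduct]

/-- An invertible saddle-point matrix only admits the zero solution of the homogeneous system. -/
theorem eq_zero_of_isUnit_fromBlocks {n m : Type*} [Fintype n] [Fintype m] [DecidableEq n]
    [DecidableEq m] {A : Matrix n n ℝ} {B : Matrix m n ℝ}
    (hK : IsUnit (Matrix.fromBlocks A Bᵀ B (0 : Matrix m m ℝ))) {x : n → ℝ} {y : m → ℝ}
    (h₁ : A *ᵥ x + Bᵀ *ᵥ y = 0) (h₂ : B *ᵥ x = 0) : x = 0 ∧ y = 0 := by
  have h : Matrix.fromBlocks A Bᵀ B 0 *ᵥ Sum.elim x y = Matrix.fromBlocks A Bᵀ B 0 *ᵥ 0 := by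
    rw [fromBlocks_mulVec, mulVec_zero]
    ext (i | i)
    · simpa using congrFun h₁ i
    · simpa using congrFun h₂ i
  have h0 := Matrix.mulVec_injective_of_isUnit hK h
  exact ⟨funext fun i => congrFun h0 (Sum.inl i), funext fun i => congrFun h0 (Sum.inr i)⟩

/-- The symmetric difference of a quadratic Lagrangian is given by its first-order part. -/
theorem quadraticLagrangian_add_sub_sub {n m : Type*} [Fintype n] [Fintype m]
    {H : Matrix n n ℝ} (hH : H.IsSymm) (G : Matrix m n ℝ) (Rx : n → ℝ) (Ry : m → ℝ)
    (x dx : n → ℝ) (y dy : m → ℝ) :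
    ((1 / 2) * ((x + dx) ⬝ᵥ (H *ᵥ (x + dx))) - Rx ⬝ᵥ (x + dx)
        + (y + dy) ⬝ᵥ (G *ᵥ (x + dx) - Ry))
      - ((1 / 2) * ((x - dx) ⬝ᵥ (H *ᵥ (x - dx))) - Rx ⬝ᵥ (x - dx)
        + (y - dy) ⬝ᵥ (G *ᵥ (x - dx) - Ry))
      = 2 * ((H *ᵥ x + Gᵀ *ᵥ y - Rx) ⬝ᵥ dx + dy ⬝ᵥ (G *ᵥ x - Ry)) := by
  have h₁ : x ⬝ᵥ (H *ᵥ dx) = (H *ᵥ x) ⬝ᵥ dx := by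
    rw [dotProduct_mulVec, ← mulVec_transpose, hH.eq]
  have h₂ : y ⬝ᵥ (G *ᵥ dx) = (Gᵀ *ᵥ y) ⬝ᵥ dx := by
    rw [dotProduct_mulVec, ← mulVec_transpose]
  have h₃ : dx ⬝ᵥ (H *ᵥ x) = (H *ᵥ x) ⬝ᵥ dx := dotProduct_comm _ _
  simp only [mulVec_add, mulVec_sub, add_dotProduct, dotProduct_add, sub_dotProduct,
    dotProduct_sub, h₁, h₂, h₃]
  ring

/-- The derivative vanishes at a centre of point symmetry. -/
theorem fderiv_eq_zero_of_symmetric {V : Type*} [NormedAddCommGroup V] [NormedSpace ℝ V]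
    {f : V → ℝ} {z : V} (h : ∀ d, f (z + d) = f (z - d)) : fderiv ℝ f z = 0 := by
  have h₁ : fderiv ℝ (fun d => f (z + d)) 0 = fderiv ℝ f z := by
    rw [fderiv_comp_add_left, add_zero]
  have h₂ : fderiv ℝ (fun d => f (z + -d)) 0 = -fderiv ℝ (fun d => f (z + d)) 0 := by
    have h := (ContinuousLinearEquiv.neg ℝ (M := V)).comp_right_fderiv
      (f := fun d => f (z + d)) (x := 0)
    ext v
    simpa [Function.comp_def] using congrArg (fun L => L v) h
  have h₃ : (fun d => f (z + -d)) = fun d => f (z + d) := by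
    funext d
    rw [h d, sub_eq_add_neg]
  rw [h₃, h₁] at h₂
  ext v
  have h₄ := congrArg (fun L => L v) h₂
  simp only [_root_.neg_apply] at h₄
  simpa using self_eq_neg.mp h₄

theorem mulVec_sumElim {l n m : Type*} [Fintype n] [Fintype m] (M : Matrix l (n ⊕ m) ℝ)
    (x : n → ℝ) (p : m → ℝ) :
    M *ᵥ Sum.elim x p = M.submatrix id Sum.inl *ᵥ x + M.submatrix id Sum.inr *ᵥ p := by
  funext i
  simp [mulVec, dotProduct, Fintype.sum_sum_type]

theorem mulVec_sumElim_inl {n m : Type*} [Fintype n] [Fintype m]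
    (M : Matrix (n ⊕ m) (n ⊕ m) ℝ) (x : n → ℝ) (p : m → ℝ) (i : n) :
    (M *ᵥ Sum.elim x p) (Sum.inl i) = (M.toBlocks₁₁ *ᵥ x) i + (M.toBlocks₁₂ *ᵥ p) i := by
  simp [mulVec, dotProduct, Fintype.sum_sum_type, toBlocks₁₁, toBlocks₁₂]

/-- Appendix, converse direction: any solution `(x̂, ŷ)` of the centralized KKT system
`Ĥ·x̂ + Ĝᵀ·ŷ = R̂x`, `Ĝ·x̂ = R̂y` decomposes into the decentralized form: writing `p`
for its boundary component, the `ι_k`-component of `x̂` equals the unique parametric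
distribution solution `x_k^I(p)`, the `ρ_k`-component of `ŷ` equals `y_k(p)`, and the
transmission components form a stationary point of the two-layer objective
`(a, q, y) ↦ Φ_T((a, q), y) + Σ_k Φ̃_k(q)`. -/
theorem centralized_kkt_decomposes_into_decentralized
    {ιT ιB ρT κ : Type*} [Fintype ιT] [Fintype ιB] [Fintype ρT] [Fintype κ]
    [DecidableEq ιT] [DecidableEq ιB] [DecidableEq ρT] [DecidableEq κ]
    {ι ρ : κ → Type*} [∀ k, Fintype (ι k)] [∀ k, Fintype (ρ k)]
    [∀ k, DecidableEq (ι k)] [∀ k, DecidableEq (ρ k)]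
    -- transmission data
    (HT : Matrix (ιT ⊕ ιB) (ιT ⊕ ιB) ℝ) (hHT : HT.IsSymm)
    (GT : Matrix ρT (ιT ⊕ ιB) ℝ) (RTx : ιT ⊕ ιB → ℝ) (RTy : ρT → ℝ)
    (ΦT : (ιT ⊕ ιB → ℝ) → (ρT → ℝ) → ℝ)
    (hΦT : ∀ x y, ΦT x y =
      (1 / 2) * (x ⬝ᵥ (HT *ᵥ x)) - RTx ⬝ᵥ x + y ⬝ᵥ (GT *ᵥ x - RTy))
    -- distribution data
    (H : ∀ k, Matrix (ι k ⊕ ιB) (ι k ⊕ ιB) ℝ) (hH : ∀ k, (H k).IsSymm)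
    (G : ∀ k, Matrix (ρ k) (ι k ⊕ ιB) ℝ)
    (Rx : ∀ k, ι k ⊕ ιB → ℝ) (Ry : ∀ k, ρ k → ℝ)
    (Φ : ∀ k, (ι k ⊕ ιB → ℝ) → (ρ k → ℝ) → ℝ)
    (hΦ : ∀ k x y, Φ k x y =
      (1 / 2) * (x ⬝ᵥ (H k *ᵥ x)) - Rx k ⬝ᵥ x + y ⬝ᵥ (G k *ᵥ x - Ry k))
    (hK : ∀ k, IsUnit (Matrix.fromBlocks (H k).toBlocks₁₁
      ((G k).submatrix id Sum.inl)ᵀ ((G k).submatrix id Sum.inl)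
      (0 : Matrix (ρ k) (ρ k) ℝ)))
    -- the (unique) parametric solutions of the distribution KKT systems
    (xI : ∀ k, (ιB → ℝ) → (ι k → ℝ)) (yD : ∀ k, (ιB → ℝ) → (ρ k → ℝ))
    (hsol : ∀ k (p : ιB → ℝ),
      (H k).toBlocks₁₁ *ᵥ xI k p + ((G k).submatrix id Sum.inl)ᵀ *ᵥ yD k p =
          (fun i => Rx k (Sum.inl i)) - (H k).toBlocks₁₂ *ᵥ p ∧
        (G k).submatrix id Sum.inl *ᵥ xI k p =
          Ry k - (G k).submatrix id Sum.inr *ᵥ p)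
    -- the boundary value functions Φ̃_k
    (Φt : ∀ _ : κ, (ιB → ℝ) → ℝ)
    (hΦt : ∀ k p, Φt k p = Φ k (Sum.elim (xI k p) p) (yD k p))
    -- assembled global data via coordinate-selection matrices
    (ET : Matrix (ιT ⊕ ιB) (ιT ⊕ ιB ⊕ (Σ k, ι k)) ℝ)
    (hET : ET = selectionMatrix
      (Sum.elim (fun i => Sum.inl i) fun b => Sum.inr (Sum.inl b)))
    (E : ∀ k, Matrix (ι k ⊕ ιB) (ιT ⊕ ιB ⊕ (Σ k, ι k)) ℝ)
    (hE : ∀ k, E k = selectionMatrix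
      (Sum.elim (fun i => Sum.inr (Sum.inr ⟨k, i⟩)) fun b => Sum.inr (Sum.inl b)))
    (Hhat : Matrix (ιT ⊕ ιB ⊕ (Σ k, ι k)) (ιT ⊕ ιB ⊕ (Σ k, ι k)) ℝ)
    (hHhat : Hhat = ETᵀ * HT * ET + ∑ k, (E k)ᵀ * H k * E k)
    (Rxhat : ιT ⊕ ιB ⊕ (Σ k, ι k) → ℝ)
    (hRxhat : Rxhat = ETᵀ *ᵥ RTx + ∑ k, (E k)ᵀ *ᵥ Rx k)
    (Ghat : Matrix (ρT ⊕ (Σ k, ρ k)) (ιT ⊕ ιB ⊕ (Σ k, ι k)) ℝ)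
    (hGhat : Ghat = Matrix.of fun r j =>
      Sum.elim (fun rT => (GT * ET) rT j) (fun s => (G s.1 * E s.1) s.2 j) r)
    (Ryhat : ρT ⊕ (Σ k, ρ k) → ℝ)
    (hRyhat : Ryhat = Sum.elim RTy fun s => Ry s.1 s.2)
    -- a solution of the centralized KKT system, and its boundary component p
    (xhat : ιT ⊕ ιB ⊕ (Σ k, ι k) → ℝ) (yhat : ρT ⊕ (Σ k, ρ k) → ℝ)
    (hcent₁ : Hhat *ᵥ xhat + Ghatᵀ *ᵥ yhat = Rxhat)
    (hcent₂ : Ghat *ᵥ xhat = Ryhat)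
    (p : ιB → ℝ) (hp : p = fun b => xhat (Sum.inr (Sum.inl b))) :
    (∀ k, (fun i => xhat (Sum.inr (Sum.inr ⟨k, i⟩))) = xI k p) ∧
    (∀ k, (fun r => yhat (Sum.inr ⟨k, r⟩)) = yD k p) ∧
    fderiv ℝ (fun z : (ιT → ℝ) × (ιB → ℝ) × (ρT → ℝ) =>
        ΦT (Sum.elim z.1 z.2.1) z.2.2 + ∑ k, Φt k z.2.1)
      (fun i => xhat (Sum.inl i), p, fun r => yhat (Sum.inl r)) = 0 := by
  have hETv : ∀ v, ET *ᵥ v =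
      Sum.elim (fun i => v (Sum.inl i)) (fun b => v (Sum.inr (Sum.inl b))) := by
    intro v
    rw [hET, selectionMatrix_mulVec]
    ext (i | i) <;> rfl
  have hEv : ∀ k v, E k *ᵥ v =
      Sum.elim (fun i => v (Sum.inr (Sum.inr ⟨k, i⟩))) (fun b => v (Sum.inr (Sum.inl b))) := by
    intro k v
    rw [hE, selectionMatrix_mulVec]
    ext (i | i) <;> rfl
  set yT : ρT → ℝ := fun r => yhat (Sum.inl r) with hyT
  set xT : ιT → ℝ := fun i => xhat (Sum.inl i) with hxT
  let X : ∀ k, ι k → ℝ := fun k i => xhat (Sum.inr (Sum.inr ⟨k, i⟩))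
  let Y : ∀ k, ρ k → ℝ := fun k r => yhat (Sum.inr ⟨k, r⟩)
  have hETx : ET *ᵥ xhat = Sum.elim xT p := by rw [hETv, hp]
  have hEx : ∀ k, E k *ᵥ xhat = Sum.elim (X k) p := fun k => by rw [hEv, hp]
  let gT : ιT ⊕ ιB → ℝ := HT *ᵥ Sum.elim xT p + GTᵀ *ᵥ yT - RTx
  let g : ∀ k, ι k ⊕ ιB → ℝ := fun k => H k *ᵥ Sum.elim (X k) p + (G k)ᵀ *ᵥ Y k - Rx k
  -- primal feasibility of each block
  have hfT : GT *ᵥ Sum.elim xT p = RTy := by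
    funext r
    have := congrFun hcent₂ (Sum.inl r)
    rw [← hETx, mulVec_mulVec]
    simpa [hGhat, hRyhat, mulVec, dotProduct] using this
  have hf : ∀ k, G k *ᵥ Sum.elim (X k) p = Ry k := by
    intro k
    funext r
    have := congrFun hcent₂ (Sum.inr ⟨k, r⟩)
    rw [← hEx, mulVec_mulVec]
    simpa [hGhat, hRyhat, mulVec, dotProduct] using this
  -- the assembled dual equation splits into the gradients of the blocks
  have hGy : Ghatᵀ *ᵥ yhat = ETᵀ *ᵥ (GTᵀ *ᵥ yT) + ∑ k, (E k)ᵀ *ᵥ ((G k)ᵀ *ᵥ Y k) := by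
    funext j
    simp only [mulVec_mulVec, ← transpose_mul, Pi.add_apply, Finset.sum_apply]
    simp only [mulVec, dotProduct, Fintype.sum_sum_type, Fintype.sum_sigma, hGhat,
      transpose_apply, of_apply, Sum.elim_inl, Sum.elim_inr, hyT, Y]
  have hsum : ETᵀ *ᵥ gT + ∑ k, (E k)ᵀ *ᵥ g k = 0 := by
    have h := hcent₁
    rw [hGy, hHhat, hRxhat, add_mulVec, sum_mulVec] at h
    simp only [← mulVec_mulVec, hETx, hEx] at h
    simp only [gT, g, mulVec_add, mulVec_sub, Finset.sum_add_distrib, Finset.sum_sub_distrib]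
    rw [← sub_eq_zero] at h
    rw [← h]
    abel
  have hdot : ∀ v, gT ⬝ᵥ (ET *ᵥ v) + ∑ k, g k ⬝ᵥ (E k *ᵥ v) = 0 := by
    intro v
    have h := congrArg (fun w => w ⬝ᵥ v) hsum
    simpa only [add_dotProduct, sum_dotProduct, mulVec_transpose, ← dotProduct_mulVec,
      zero_dotProduct] using h
  have hgI : ∀ k i, g k (Sum.inl i) = 0 := by
    intro k i
    have h := hdot (Pi.single (Sum.inr (Sum.inr ⟨k, i⟩)) 1)
    rw [Finset.sum_eq_single k] at h
    · simpa [hETv, hEv, dotProduct, Fintype.sum_sum_type, Pi.single_apply] using h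
    · intro j _ hj
      simp [hEv, dotProduct, hj]
    · simp
  have hXY : ∀ k, X k = xI k p ∧ Y k = yD k p := by
    intro k
    obtain ⟨h₁, h₂⟩ := hsol k p
    have h := eq_zero_of_isUnit_fromBlocks (hK k) (x := X k - xI k p) (y := Y k - yD k p) ?_ ?_
    · exact ⟨sub_eq_zero.mp h.1, sub_eq_zero.mp h.2⟩
    · funext i
      have e₁ := congrFun h₁ i
      have e₂ := hgI k i
      have e₃ : ((G k)ᵀ *ᵥ Y k) (Sum.inl i) = (((G k).submatrix id Sum.inl)ᵀ *ᵥ Y k) i := rfl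
      simp only [g, Pi.add_apply, Pi.sub_apply, mulVec_sumElim_inl, e₃] at e₁ e₂
      simp only [mulVec_sub, Pi.add_apply, Pi.sub_apply, Pi.zero_apply]
      linarith
    · have e := hf k
      rw [mulVec_sumElim] at e
      rw [mulVec_sub, h₂, ← e]
      abel
  refine ⟨fun k => (hXY k).1, fun k => (hXY k).2, fderiv_eq_zero_of_symmetric ?_⟩
  rintro ⟨a, q, w⟩
  -- the parametric solutions are affine in the boundary value
  have hodd : ∀ k, xI k (p + q) + xI k (p - q) - (2 : ℝ) • xI k p = 0 ∧
      yD k (p + q) + yD k (p - q) - (2 : ℝ) • yD k p = 0 := by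
    intro k
    obtain ⟨h₁, h₂⟩ := hsol k p
    obtain ⟨h₃, h₄⟩ := hsol k (p + q)
    obtain ⟨h₅, h₆⟩ := hsol k (p - q)
    refine eq_zero_of_isUnit_fromBlocks (hK k) ?_ ?_
    · funext i
      have e₁ := congrFun h₁ i
      have e₃ := congrFun h₃ i
      have e₅ := congrFun h₅ i
      simp only [mulVec_sub, mulVec_add, mulVec_smul, Pi.add_apply, Pi.sub_apply, Pi.smul_apply,
        Pi.zero_apply, smul_eq_mul] at *
      linarith
    · funext i
      have e₂ := congrFun h₂ i
      have e₄ := congrFun h₄ i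
      have e₆ := congrFun h₆ i
      simp only [mulVec_sub, mulVec_add, mulVec_smul, Pi.add_apply, Pi.sub_apply, Pi.smul_apply,
        Pi.zero_apply, smul_eq_mul] at *
      linarith
  let dx : ∀ k, ι k → ℝ := fun k => xI k (p + q) - xI k p
  let dy : ∀ k, ρ k → ℝ := fun k => yD k (p + q) - yD k p
  have hdiffT : ΦT (Sum.elim (xT + a) (p + q)) (yT + w) - ΦT (Sum.elim (xT - a) (p - q)) (yT - w)
      = 2 * (gT ⬝ᵥ Sum.elim a q) := by
    have hadd : Sum.elim (xT + a) (p + q) = Sum.elim xT p + Sum.elim a q := by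
      ext (i | i) <;> rfl
    have hsub : Sum.elim (xT - a) (p - q) = Sum.elim xT p - Sum.elim a q := by
      ext (i | i) <;> rfl
    rw [hΦT, hΦT, hadd, hsub, quadraticLagrangian_add_sub_sub hHT, hfT, sub_self,
      dotProduct_zero, add_zero]
  have hdiff : ∀ k, Φt k (p + q) - Φt k (p - q) = 2 * (g k ⬝ᵥ Sum.elim (dx k) q) := by
    intro k
    obtain ⟨hX, hY⟩ := hXY k
    obtain ⟨o₁, o₂⟩ := hodd k
    have hadd : Sum.elim (xI k (p + q)) (p + q) = Sum.elim (X k) p + Sum.elim (dx k) q := by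
      ext (i | i) <;> simp [dx, hX]
    have hsub : Sum.elim (xI k (p - q)) (p - q) = Sum.elim (X k) p - Sum.elim (dx k) q := by
      ext (i | i)
      · have := congrFun o₁ i
        simp only [Pi.add_apply, Pi.sub_apply, Pi.smul_apply, Pi.zero_apply, smul_eq_mul] at this
        simp only [dx, hX, Sum.elim_inl, Pi.sub_apply]
        linarith
      · rfl
    have hyadd : yD k (p + q) = Y k + dy k := by simp [dy, hY]
    have hysub : yD k (p - q) = Y k - dy k := by
      funext i
      have := congrFun o₂ i
      simp only [Pi.add_apply, Pi.sub_apply, Pi.smul_apply, Pi.zero_apply, smul_eq_mul] at this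
      simp only [dy, hY, Pi.sub_apply]
      linarith
    rw [hΦt, hΦt, hΦ, hΦ, hadd, hsub, hyadd, hysub, quadraticLagrangian_add_sub_sub (hH k),
      hf k, sub_self, dotProduct_zero, add_zero]
  have hzero := hdot (Sum.elim a (Sum.elim q fun s => dx s.1 s.2))
  simp only [hETv, hEv, Sum.elim_inl, Sum.elim_inr] at hzero
  have hsumdiff : ∑ k, Φt k (p + q) - ∑ k, Φt k (p - q)
      = 2 * ∑ k, g k ⬝ᵥ Sum.elim (dx k) q := by
    rw [← Finset.sum_sub_distrib, Finset.mul_sum]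
    exact Finset.sum_congr rfl fun k _ => hdiff k
  change ΦT (Sum.elim (xT + a) (p + q)) (yT + w) + ∑ k, Φt k (p + q)
    = ΦT (Sum.elim (xT - a) (p - q)) (yT - w) + ∑ k, Φt k (p - q)
  linarith
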